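/- Let A be an n×n binary array with a maximal sequence of vertical boundaries b₁ < … < b_k (k ≥ 1) with shadows b'₁, …, b'_k and types t₁, …, t_k with respect to a real threshold c > 0. Then for every index i with 1 ≤ i ≤ k such that b'_i ≠ b_i, the subarray A[1..b_i] consisting of columns 1 through b_i can be tiled into at most t₁ + t₂ + … + t_i tiles each of weight at most c. -/

import Mathlib

/-- `A` is a binary array: every entry is `0` or `1`. -/
def Binary (A : ℕ → ℕ → ℕ) : Prop := ∀ r c, A r c ≤ 1

/-- `colW n A i j` is the total weight of columns `i` through `j` of the `n×n` array `A`
(rows and columns indexed `1,…,n`); it is `0` when the column range is empty. -/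
def colW (n : ℕ) (A : ℕ → ℕ → ℕ) (i j : ℕ) : ℕ :=
  ∑ r ∈ Finset.Icc 1 n, ∑ col ∈ Finset.Icc i j, A r col

/-- The subarray of `A` consisting of columns `i..j` can be partitioned horizontally into
`m` tiles of weight at most `c`: the rows `{1,…,n}` are split into `m` contiguous
(possibly empty) intervals by cut points `f 0 = 0 ≤ f 1 ≤ … ≤ f m = n` (the `t`-th
interval being rows `{f t + 1, …, f (t+1)}`), and the weight of each tile is `≤ c`. -/
def HorizPartition (n : ℕ) (A : ℕ → ℕ → ℕ) (i j m : ℕ) (c : ℝ) : Prop :=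
  ∃ f : ℕ → ℕ, Monotone f ∧ f 0 = 0 ∧ f m = n ∧
    ∀ t < m,
      (∑ r ∈ Finset.Ioc (f t) (f (t + 1)), ∑ col ∈ Finset.Icc i j, (A r col : ℝ)) ≤ c

/-- A maximal sequence of `k` vertical boundaries of the `n×n` array `A` with respect to
the threshold `c`, as in Definition 1 of the paper: boundary columns
`1 ≤ b 1 < b 2 < … < b k ≤ n`, shadows `sh i ∈ {b i, b i + 1}`, and types
`t i = ⌊w(A[b i..b i])/c⌋ + 1`, satisfying the iterative defining conditions (1)–(5)
together with the maximality condition (6) at the last boundary. -/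
structure VBoundaries (n : ℕ) (A : ℕ → ℕ → ℕ) (c : ℝ) (k : ℕ) where
  /-- the boundary columns `b 1, …, b k` -/
  b : ℕ → ℕ
  /-- the shadow columns `sh 1, …, sh k` -/
  sh : ℕ → ℕ
  /-- the types `t 1, …, t k` -/
  t : ℕ → ℕ
  one_le_b : 1 ≤ b 1
  b_le_n : b k ≤ n
  strict : ∀ i, 1 ≤ i → i < k → b i < b (i + 1)
  shadow_mem : ∀ i, 1 ≤ i → i ≤ k → sh i = b i ∨ sh i = b i + 1
  type_def : ∀ i, 1 ≤ i → i ≤ k → t i = ⌊(colW n A (b i) (b i) : ℝ) / c⌋₊ + 1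
  /-- (1): the first boundary is where the prefix weight first exceeds `c`. -/
  first_le : (colW n A 1 (b 1 - 1) : ℝ) ≤ c
  first_gt : (colW n A 1 (b 1) : ℝ) > c
  /-- (2): the first shadow. -/
  shadow_one : sh 1 = b 1 ↔ ¬ HorizPartition n A 1 (b 1) (t 1) c
  /-- (3): the next boundary, case `sh i = b i`. -/
  step_eq : ∀ i, 1 ≤ i → i < k → sh i = b i →
    HorizPartition n A (b i) (b (i + 1) - 1) (t i) c ∧
      ¬ HorizPartition n A (b i) (b (i + 1)) (t i) c
  /-- (4): the next boundary, case `sh i ≠ b i`. -/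
  step_ne : ∀ i, 1 ≤ i → i < k → sh i ≠ b i →
    (colW n A (b i + 1) (b (i + 1) - 1) : ℝ) ≤ c ∧
      (colW n A (b i + 1) (b (i + 1)) : ℝ) > c
  /-- (5): the next shadow. -/
  shadow_succ : ∀ i, 1 ≤ i → i < k →
    (sh (i + 1) = b (i + 1) ↔ ¬ HorizPartition n A (sh i) (b (i + 1)) (t (i + 1)) c)
  /-- (6): maximality, case `sh k = b k`. -/
  max_eq : sh k = b k → HorizPartition n A (b k) n (t k) c
  /-- (6): maximality, case `sh k ≠ b k`. -/
  max_ne : sh k ≠ b k → (colW n A (b k + 1) n : ℝ) ≤ c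

/-- `R` is an axis-aligned rectangle: the product of a contiguous row interval and a
contiguous column interval (possibly empty). -/
def IsRect (R : Finset (ℕ × ℕ)) : Prop :=
  ∃ r₁ r₂ c₁ c₂ : ℕ, R = Finset.Icc r₁ r₂ ×ˢ Finset.Icc c₁ c₂

/-- The set of cells `S` can be tiled with at most `N` pairwise disjoint axis-aligned
rectangles whose union is `S` and each of whose weights (sum of entries of `A`) is at
most `c`. -/
def TiledBy (A : ℕ → ℕ → ℕ) (S : Finset (ℕ × ℕ)) (N : ℕ) (c : ℝ) : Prop :=
  ∃ T : Finset (Finset (ℕ × ℕ)), T.card ≤ N ∧ (∀ R ∈ T, IsRect R) ∧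
    (T : Set (Finset (ℕ × ℕ))).PairwiseDisjoint id ∧ T.sup id = S ∧
    ∀ R ∈ T, (∑ p ∈ R, (A p.1 p.2 : ℝ)) ≤ c

/-- The full grid of cells `{1,…,n} × {1,…,n}`. -/
def grid (n : ℕ) : Finset (ℕ × ℕ) := Finset.Icc 1 n ×ˢ Finset.Icc 1 n

theorem TiledBy.mono' {A : ℕ → ℕ → ℕ} {S : Finset (ℕ × ℕ)} {N M : ℕ} {c : ℝ}
    (h : TiledBy A S N c) (hNM : N ≤ M) : TiledBy A S M c := by
  obtain ⟨T, h1, h2⟩ := h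
  exact ⟨T, h1.trans hNM, h2⟩

theorem TiledBy.union' {A : ℕ → ℕ → ℕ} {S S' : Finset (ℕ × ℕ)} {N M : ℕ} {c : ℝ}
    (h : TiledBy A S N c) (h' : TiledBy A S' M c) (hd : Disjoint S S') :
    TiledBy A (S ∪ S') (N + M) c := by
  classical
  obtain ⟨T, h1, h2, h3, h4, h5⟩ := h
  obtain ⟨T', h1', h2', h3', h4', h5'⟩ := h'
  refine ⟨T ∪ T', (Finset.card_union_le _ _).trans (by omega), ?_, ?_, ?_, ?_⟩
  · intro R hR
    rcases Finset.mem_union.1 hR with hR | hR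
    exacts [h2 R hR, h2' R hR]
  · have key : ∀ R ∈ T, ∀ R' ∈ T', Disjoint R R' := by
      intro R hR R' hR'
      have a : R ≤ S := h4 ▸ Finset.le_sup (f := id) hR
      have b : R' ≤ S' := h4' ▸ Finset.le_sup (f := id) hR'
      exact hd.mono a b
    intro R hR R' hR' hne
    simp only [Finset.coe_union, Set.mem_union, Finset.mem_coe] at hR hR'
    rcases hR with hR | hR <;> rcases hR' with hR' | hR'
    · exact h3 hR hR' hne
    · exact key R hR R' hR'
    · exact (key R' hR' R hR).symm
    · exact h3' hR hR' hne
  · rw [Finset.sup_union, h4, h4']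
    rfl
  · intro R hR
    rcases Finset.mem_union.1 hR with hR | hR
    exacts [h5 R hR, h5' R hR]

theorem TiledBy.single' (A : ℕ → ℕ → ℕ) (r₁ r₂ c₁ c₂ : ℕ) (c : ℝ)
    (h : (∑ r ∈ Finset.Icc r₁ r₂, ∑ col ∈ Finset.Icc c₁ c₂, (A r col : ℝ)) ≤ c) :
    TiledBy A (Finset.Icc r₁ r₂ ×ˢ Finset.Icc c₁ c₂) 1 c := by
  refine ⟨{Finset.Icc r₁ r₂ ×ˢ Finset.Icc c₁ c₂}, by simp, ?_, by simp, by simp, ?_⟩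
  · intro R hR
    exact ⟨r₁, r₂, c₁, c₂, by simpa using hR⟩
  · intro R hR
    rw [Finset.mem_singleton.1 hR, Finset.sum_product]
    exact h

theorem TiledBy.ofColW {n : ℕ} {A : ℕ → ℕ → ℕ} {i j : ℕ} {c : ℝ}
    (h : (colW n A i j : ℝ) ≤ c) :
    TiledBy A (Finset.Icc 1 n ×ˢ Finset.Icc i j) 1 c := by
  apply TiledBy.single'
  simpa [colW] using h

theorem TiledBy.ofHP {n : ℕ} {A : ℕ → ℕ → ℕ} {i j m : ℕ} {c : ℝ}
    (h : HorizPartition n A i j m c) :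
    TiledBy A (Finset.Icc 1 n ×ˢ Finset.Icc i j) m c := by
  obtain ⟨f, hf, h0, hm, hw⟩ := h
  rw [← hm]
  have : ∀ s ≤ m, TiledBy A (Finset.Icc 1 (f s) ×ˢ Finset.Icc i j) s c := by
    intro s
    induction s with
    | zero =>
      intro _
      exact ⟨∅, by simp [h0]⟩
    | succ s ih =>
      intro hs
      have h1 := ih (by omega)
      have h2 : TiledBy A (Finset.Icc (f s + 1) (f (s + 1)) ×ˢ Finset.Icc i j) 1 c := by
        apply TiledBy.single'
        have e : Finset.Icc (f s + 1) (f (s + 1)) = Finset.Ioc (f s) (f (s + 1)) := by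
          ext x; simp only [Finset.mem_Icc, Finset.mem_Ioc]; omega
        rw [e]
        exact hw s (by omega)
      have hle := hf (Nat.le_succ s)
      have h3 := h1.union' h2 (by
        rw [Finset.disjoint_left]
        intro p hp hp'
        simp only [Finset.mem_product, Finset.mem_Icc] at hp hp'
        omega)
      convert h3 using 1
      ext p
      simp only [Finset.mem_product, Finset.mem_Icc, Finset.mem_union]
      simp only [Nat.succ_eq_add_one] at hle
      omega
  exact this m le_rfl

theorem TiledBy.append {n : ℕ} {A : ℕ → ℕ → ℕ} {x x' y N M : ℕ} {c : ℝ}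
    (h : TiledBy A (Finset.Icc 1 n ×ˢ Finset.Icc 1 x) N c)
    (h' : TiledBy A (Finset.Icc 1 n ×ˢ Finset.Icc x' y) M c) (hx : x' = x + 1) (hy : x ≤ y) :
    TiledBy A (Finset.Icc 1 n ×ˢ Finset.Icc 1 y) (N + M) c := by
  have h3 := h.union' h' (by
    rw [Finset.disjoint_left]
    intro p hp hp'
    simp only [Finset.mem_product, Finset.mem_Icc] at hp hp'
    omega)
  convert h3 using 1
  ext p
  simp only [Finset.mem_product, Finset.mem_Icc, Finset.mem_union]
  omega

theorem VBoundaries.claim {n : ℕ} {A : ℕ → ℕ → ℕ} {c : ℝ} {k : ℕ} (B : VBoundaries n A c k) :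
    ∀ i, i + 1 ≤ k → 1 ≤ B.b (i + 1) ∧
      (B.sh (i + 1) ≠ B.b (i + 1) → TiledBy A (Finset.Icc 1 n ×ˢ Finset.Icc 1 (B.b (i + 1)))
        (∑ j ∈ Finset.Icc 1 (i + 1), B.t j) c) ∧
      (B.sh (i + 1) = B.b (i + 1) → TiledBy A (Finset.Icc 1 n ×ˢ Finset.Icc 1 (B.b (i + 1) - 1))
        (∑ j ∈ Finset.Icc 1 i, B.t j + 1) c) := by
  intro i
  induction i with
  | zero =>
    intro _
    refine ⟨B.one_le_b, ?_, ?_⟩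
    · intro h
      have := TiledBy.ofHP (not_not.1 (fun h' => h (B.shadow_one.2 h')))
      simpa using this
    · intro h
      simpa using TiledBy.ofColW B.first_le
  | succ i ih =>
    intro hi
    obtain ⟨hb, h1, h2⟩ := ih (by omega)
    have hs := B.strict (i + 1) (by omega) (by omega)
    have hS := B.shadow_succ (i + 1) (by omega) (by omega)
    have hmem := B.shadow_mem (i + 1) (by omega) (by omega)
    have ht := B.type_def (i + 1) (by omega) (by omega)
    have e1 : ∑ j ∈ Finset.Icc 1 (i + 1), B.t j = ∑ j ∈ Finset.Icc 1 i, B.t j + B.t (i + 1) :=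
      Finset.sum_Icc_succ_top (by omega) _
    have e2 : ∑ j ∈ Finset.Icc 1 (i + 1 + 1), B.t j
        = ∑ j ∈ Finset.Icc 1 (i + 1), B.t j + B.t (i + 1 + 1) :=
      Finset.sum_Icc_succ_top (by omega) _
    refine ⟨by omega, ?_, ?_⟩
    · intro h
      have hp := TiledBy.ofHP (not_not.1 (fun h' => h (hS.2 h')))
      by_cases hq : B.sh (i + 1) = B.b (i + 1)
      · exact ((h2 hq).append hp (by omega) (by omega)).mono' (by omega)
      · exact ((h1 hq).append hp (by omega) (by omega)).mono' (by omega)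
    · intro h
      by_cases hq : B.sh (i + 1) = B.b (i + 1)
      · have hp := TiledBy.ofHP (B.step_eq (i + 1) (by omega) (by omega) hq).1
        exact ((h2 hq).append hp (by omega) (by omega)).mono' (by omega)
      · have hp := TiledBy.ofColW (B.step_ne (i + 1) (by omega) (by omega) hq).1
        exact ((h1 hq).append hp (by omega) (by omega)).mono' (by omega)

/-- In a maximal sequence of `k ≥ 1` vertical boundaries of `A` w.r.t.
the threshold `c > 0`: for every `1 ≤ i ≤ k` with `sh i ≠ b i`, the subarray of `A`
consisting of columns `1` through `b i` can be tiled into at most `t₁ + … + t_i`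
axis-aligned rectangular tiles each of weight at most `c`. -/
theorem stmt7 (n : ℕ) (A : ℕ → ℕ → ℕ) (hA : Binary A) (c : ℝ) (hc : 0 < c)
    (k : ℕ) (hk : 1 ≤ k) (B : VBoundaries n A c k) :
    ∀ i, 1 ≤ i → i ≤ k → B.sh i ≠ B.b i →
      TiledBy A (Finset.Icc 1 n ×ˢ Finset.Icc 1 (B.b i))
        (∑ j ∈ Finset.Icc 1 i, B.t j) c := by
  intro i h1 hik h
  obtain ⟨i, rfl⟩ : ∃ i', i = i' + 1 := ⟨i - 1, by omega⟩
  exact (B.claim i hik).2.1 h
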